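/- Weighted sum formula (Guo–Xie type): for any integer l ≥ 4, Σ_{l1≥2, l2,l3≥1, l1+l2+l3=l} (2^{l1+l2-1} + 2^{l1-1} - 2^{l2}) · ζ(l1,l2,l3) = l·ζ(l). -/

import Mathlib

/-- Riemann zeta value -/
noncomputable def rz (l : ℕ) : ℝ :=
  ∑' m : ℕ, if 0 < m then 1 / (m : ℝ) ^ l else 0

/-- double zeta value -/
noncomputable def dz (a b : ℕ) : ℝ :=
  ∑' p : ℕ × ℕ, if p.2 < p.1 ∧ 0 < p.2 then
    1 / ((p.1 : ℝ) ^ a * (p.2 : ℝ) ^ b) else 0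

/-- triple zeta value -/
noncomputable def tz (a b c : ℕ) : ℝ :=
  ∑' t : ℕ × ℕ × ℕ, if t.2.1 < t.1 ∧ t.2.2 < t.2.1 ∧ 0 < t.2.2 then
    1 / ((t.1 : ℝ) ^ a * (t.2.1 : ℝ) ^ b * (t.2.2 : ℝ) ^ c) else 0

/-- admissible triple indices of weight l -/
def TIdx (l : ℕ) : Finset (ℕ × ℕ × ℕ) :=
  (Finset.range (l + 1) ×ˢ Finset.range (l + 1) ×ˢ Finset.range (l + 1)).filter
    (fun t => 2 ≤ t.1 ∧ 1 ≤ t.2.1 ∧ 1 ≤ t.2.2 ∧ t.1 + t.2.1 + t.2.2 = l)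

open Finset

section ring_identity

variable {R : Type*} [CommRing R] {u v c : ℕ → R}

/-- Nested sum of `u` over strictly decreasing chains of length `r` below `n`. -/
def chainSum (u : ℕ → R) : ℕ → ℕ → R
  | 0, _ => 1
  | r + 1, n => ∑ j ∈ range n, u j * chainSum u r j

theorem chainSum_succ_succ (u : ℕ → R) (r n : ℕ) :
    chainSum u (r + 1) (n + 1) = chainSum u (r + 1) n + u n * chainSum u r n := by
  simp [chainSum, sum_range_succ]

theorem chainSum_one_succ (u : ℕ → R) (n : ℕ) :
    chainSum u 1 (n + 1) = chainSum u 1 n + u n := by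
  simp [chainSum, sum_range_succ]

theorem chainSum_one_sq (u : ℕ → R) (n : ℕ) :
    chainSum u 1 n ^ 2 = 2 * chainSum u 2 n + ∑ j ∈ range n, u j ^ 2 := by
  induction n with
  | zero => simp [chainSum]
  | succ n ih =>
    rw [chainSum_one_succ, chainSum_succ_succ, sum_range_succ]
    linear_combination ih

theorem sum_convolution_eq (u : ℕ → R) (N : ℕ) :
    ∑ p ∈ range N, ∑ i ∈ range p, u i * u (p - 1 - i) =
      ∑ p ∈ range N, chainSum u 1 p * u (N - 1 - p) := by
  simp only [chainSum, mul_one, sum_mul, sum_sigma']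
  refine sum_nbij' (fun x => ⟨N - x.1 + x.2, x.2⟩) (fun x => ⟨N - x.1 + x.2, x.2⟩) ?_ ?_ ?_ ?_ ?_
  all_goals rintro ⟨p, i⟩ h
  all_goals simp only [mem_sigma, mem_range] at h ⊢
  · omega
  · omega
  · congr 1; omega
  · congr 1; omega
  · congr 2; omega

theorem two_mul_chainSum_one (huv : ∀ i j, u i * u j = v (i + j + 1) * (u i + u j)) (p : ℕ) :
    2 * (v p * chainSum u 1 p) = ∑ i ∈ range p, u i * u (p - 1 - i) := by
  have h : ∀ i ∈ range p, u i * u (p - 1 - i) = v p * (u i + u (p - 1 - i)) := by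
    intro i hi
    rw [mem_range] at hi
    rw [huv]
    congr 2; omega
  rw [sum_congr rfl h, ← mul_sum, sum_add_distrib, sum_range_reflect u p]
  simp only [chainSum, mul_one]
  ring

theorem two_mul_sum_chainSum_one (huv : ∀ i j, u i * u j = v (i + j + 1) * (u i + u j)) (N : ℕ) :
    2 * ∑ p ∈ range N, v p * chainSum u 1 p =
      ∑ p ∈ range N, chainSum u 1 p * u (N - 1 - p) := by
  rw [← sum_convolution_eq, mul_sum]
  exact sum_congr rfl fun p _ => two_mul_chainSum_one huv p

theorem chainSum_one_sub_succ (u : ℕ → R) {N p : ℕ} (hp : p < N) :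
    chainSum u 1 (N + 1 - 1 - p) = chainSum u 1 (N - 1 - p) + u (N - 1 - p) := by
  rw [← chainSum_one_succ]; congr 1; omega

theorem shuffle_triple_sum (huv : ∀ i j, u i * u j = v (i + j + 1) * (u i + u j)) (N : ℕ) :
    2 * ∑ m ∈ range N, v m * ∑ p ∈ range m, v p * chainSum u 1 p +
      ∑ m ∈ range N, v m * chainSum u 2 m =
    ∑ p ∈ range N, u p * chainSum u 1 p * chainSum u 1 (N - 1 - p) := by
  induction N with
  | zero => simp
  | succ N ih =>
    have h1 : ∑ p ∈ range N, u p * chainSum u 1 p * chainSum u 1 (N + 1 - 1 - p) =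
        ∑ p ∈ range N, u p * chainSum u 1 p * chainSum u 1 (N - 1 - p) +
        ∑ p ∈ range N, v N * (u p * chainSum u 1 p + chainSum u 1 p * u (N - 1 - p)) := by
      rw [← sum_add_distrib]
      refine sum_congr rfl fun p hp => ?_
      rw [mem_range] at hp
      have h := huv p (N - 1 - p)
      rw [show p + (N - 1 - p) + 1 = N by omega] at h
      rw [chainSum_one_sub_succ u hp]
      linear_combination chainSum u 1 p * h
    have h0 : chainSum u 1 (N + 1 - 1 - N) = 0 := by simp [chainSum]
    have h2 : ∑ p ∈ range N, u p * chainSum u 1 p = chainSum u 2 N := rfl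
    rw [sum_range_succ, sum_range_succ, sum_range_succ, h0, h1, ← ih, ← mul_sum, sum_add_distrib,
      ← two_mul_sum_chainSum_one huv, h2]
    ring

theorem partial_fraction_triple_sum (huv : ∀ i j, u i * u j = v (i + j + 1) * (u i + u j))
    (hc : ∀ p q, c p * (u q - u (p + q + 1)) = u q * u (p + q + 1)) (N : ℕ) :
    2 * ∑ m ∈ range N, u m * ∑ p ∈ range m, v p * chainSum u 1 p =
    ∑ p ∈ range N, c p * chainSum u 1 p *
      (chainSum u 1 (p + 1) + chainSum u 1 (N - 1 - p) - chainSum u 1 N) := by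
  induction N with
  | zero => simp
  | succ N ih =>
    have h1 : ∑ p ∈ range N, c p * chainSum u 1 p *
          (chainSum u 1 (p + 1) + chainSum u 1 (N + 1 - 1 - p) - chainSum u 1 (N + 1)) =
        ∑ p ∈ range N, c p * chainSum u 1 p *
          (chainSum u 1 (p + 1) + chainSum u 1 (N - 1 - p) - chainSum u 1 N) +
        ∑ p ∈ range N, u N * (chainSum u 1 p * u (N - 1 - p)) := by
      rw [← sum_add_distrib]
      refine sum_congr rfl fun p hp => ?_
      rw [mem_range] at hp
      have h := hc p (N - 1 - p)
      rw [show p + (N - 1 - p) + 1 = N by omega] at h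
      rw [chainSum_one_sub_succ u hp, chainSum_one_succ u N]
      linear_combination chainSum u 1 p * h
    have h0 : chainSum u 1 (N + 1 - 1 - N) = 0 := by simp [chainSum]
    rw [sum_range_succ, sum_range_succ, h0, h1, ← ih, ← mul_sum, ← two_mul_sum_chainSum_one huv]
    ring

theorem telescoping_triple_sum (N : ℕ) :
    chainSum u 1 N * chainSum u 2 N -
      ∑ p ∈ range N, c p * (chainSum u 1 p * chainSum u 1 (p + 1) + chainSum u 2 p) =
    ∑ p ∈ range N, (u p - c p) *
      (3 * chainSum u 2 p + ∑ j ∈ range p, u j ^ 2 + u p * chainSum u 1 p) := by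
  induction N with
  | zero => simp [chainSum]
  | succ N ih =>
    rw [sum_range_succ, sum_range_succ, ← ih, chainSum_one_succ, chainSum_succ_succ]
    linear_combination (u N - c N) * chainSum_one_sq u N

/-- The truncated weighted sum equals a combination of depth two and three sums, up to
an error that vanishes in the limit. -/
theorem truncated_weighted_sum (huv : ∀ i j, u i * u j = v (i + j + 1) * (u i + u j))
    (hc : ∀ p q, c p * (u q - u (p + q + 1)) = u q * u (p + q + 1)) (N : ℕ) :
    2 * ∑ m ∈ range N, v m * ∑ p ∈ range m, v p * chainSum u 1 p +
      ∑ m ∈ range N, v m * chainSum u 2 m -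
      2 * ∑ m ∈ range N, u m * ∑ p ∈ range m, v p * chainSum u 1 p -
      ∑ m ∈ range N, c m * chainSum u 2 m =
    ∑ p ∈ range N, (u p - c p) *
      (3 * chainSum u 2 p + ∑ j ∈ range p, u j ^ 2 + u p * chainSum u 1 p) -
    ∑ p ∈ range N, (u p - c p) * chainSum u 1 p * (chainSum u 1 N - chainSum u 1 (N - 1 - p)) := by
  have h2 : chainSum u 2 N = ∑ p ∈ range N, u p * chainSum u 1 p := rfl
  rw [shuffle_triple_sum huv, partial_fraction_triple_sum huv hc, ← telescoping_triple_sum, h2,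
    mul_sum]
  simp only [← sum_sub_distrib]
  exact sum_congr rfl fun p _ => by ring

end ring_identity

section interchange

theorem HasSum.of_eq {f g : ℕ → ℝ} {s : ℝ} (h : HasSum f s) (hfg : ∀ i, g i = f i) :
    HasSum g s := by
  rwa [funext hfg]

/-- Tonelli's theorem for nonnegative double series whose row sums are summable. -/
theorem HasSum.swap_of_nonneg {F : ℕ → ℕ → ℝ} {A B : ℕ → ℝ} {s : ℝ} (hF : ∀ i j, 0 ≤ F i j)
    (hA : ∀ i, HasSum (F i) (A i)) (hB : ∀ j, HasSum (fun i => F i j) (B j)) (hs : HasSum A s) :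
    HasSum B s := by
  have hsum : Summable (fun x : ℕ × ℕ => F x.1 x.2) := by
    refine (summable_prod_of_nonneg fun x => hF x.1 x.2).2 ⟨fun i => (hA i).summable, ?_⟩
    simpa only [(hA _).tsum_eq] using hs.summable
  have h1 : HasSum A (∑' x : ℕ × ℕ, F x.1 x.2) := hsum.hasSum.prod_fiberwise hA
  have h2 : HasSum (fun x : ℕ × ℕ => F x.2 x.1) (∑' x : ℕ × ℕ, F x.1 x.2) :=
    (Equiv.prodComm ℕ ℕ).hasSum_iff.2 hsum.hasSum
  rw [hs.unique h1]
  exact h2.prod_fiberwise hB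

theorem HasSum.mul_sum_range_of_nonneg {f g F : ℕ → ℝ} {s : ℝ} (hf : ∀ i, 0 ≤ f i)
    (hg : ∀ i, 0 ≤ g i) (hF : ∀ j, HasSum (fun d => f (d + (j + 1))) (F j))
    (hs : HasSum (fun j => g j * F j) s) :
    HasSum (fun i => f i * ∑ j ∈ range i, g j) s := by
  refine HasSum.swap_of_nonneg (F := fun j i => if j < i then f i * g j else 0) ?_ ?_ ?_ hs
  · intro j i
    split_ifs
    · exact mul_nonneg (hf i) (hg j)
    · exact le_rfl
  · intro j
    refine (hasSum_nat_add_iff' (j + 1)).1 ?_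
    rw [sum_eq_zero, sub_zero]
    · refine HasSum.of_eq ((hF j).mul_left (g j)) fun d => ?_
      rw [if_pos (by omega), mul_comm]
    · intro i hi
      rw [mem_range] at hi
      rw [if_neg (by omega)]
  · intro i
    rw [mul_sum, ← sum_congr rfl fun j hj =>
      if_pos (t := f i * g j) (e := (0 : ℝ)) (mem_range.1 hj)]
    exact hasSum_sum_of_ne_finset_zero fun j hj => if_neg fun h => hj (mem_range.2 h)

end interchange
section connector

/-- Shifted factorial `(1 - t)(2 - t)⋯(n - t)`. -/
noncomputable def shiftedFactorial (t : ℝ) (n : ℕ) : ℝ := ∏ i ∈ range n, ((i : ℝ) + 1 - t)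

/-- The Seki–Yamamoto connector. -/
noncomputable def connector (t : ℝ) (m n : ℕ) : ℝ :=
  shiftedFactorial t m * shiftedFactorial t n / shiftedFactorial t (m + n)

variable {t : ℝ}

theorem shiftedFactorial_pos (ht : t < 1) (n : ℕ) : 0 < shiftedFactorial t n :=
  prod_pos fun i _ => by have : (0 : ℝ) ≤ i := i.cast_nonneg; linarith

theorem shiftedFactorial_succ (t : ℝ) (n : ℕ) :
    shiftedFactorial t (n + 1) = shiftedFactorial t n * ((n : ℝ) + 1 - t) :=
  prod_range_succ _ _

theorem connector_pos (ht : t < 1) (m n : ℕ) : 0 < connector t m n :=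
  div_pos (mul_pos (shiftedFactorial_pos ht m) (shiftedFactorial_pos ht n))
    (shiftedFactorial_pos ht _)

theorem connector_comm (t : ℝ) (m n : ℕ) : connector t m n = connector t n m := by
  rw [connector, connector, add_comm m n, mul_comm (shiftedFactorial t m)]

theorem connector_zero_left (ht : t < 1) (n : ℕ) : connector t 0 n = 1 := by
  have h0 : shiftedFactorial t 0 = 1 := prod_range_zero _
  rw [connector, zero_add, h0, one_mul, div_self (shiftedFactorial_pos ht n).ne']

theorem connector_sub_succ (ht : t < 1) (m n : ℕ) :
    connector t m n - connector t (m + 1) n =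
      n * (connector t (m + 1) n * (1 / ((m : ℝ) + 1 - t))) := by
  have h1 : (0 : ℝ) < (m : ℝ) + 1 - t := by have : (0 : ℝ) ≤ m := m.cast_nonneg; linarith
  have h2 : (0 : ℝ) < (m : ℝ) + n + 1 - t := by
    have : (0 : ℝ) ≤ n := n.cast_nonneg; linarith
  have h3 := (shiftedFactorial_pos ht (m + n)).ne'
  rw [connector, connector, show m + 1 + n = (m + n) + 1 by ring, shiftedFactorial_succ,
    shiftedFactorial_succ]
  push_cast
  field_simp
  ring

theorem connector_antitone_left (ht : t < 1) (n : ℕ) : Antitone fun m => connector t m n := by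
  refine antitone_nat_of_succ_le fun m => ?_
  have h1 : (0 : ℝ) < (m : ℝ) + 1 - t := by have : (0 : ℝ) ≤ m := m.cast_nonneg; linarith
  have h2 := connector_pos ht (m + 1) n
  have h3 := connector_sub_succ ht m n
  have h4 : 0 ≤ n * (connector t (m + 1) n * (1 / ((m : ℝ) + 1 - t))) := by positivity
  linarith

theorem tendsto_connector_left (ht : t < 1) {n : ℕ} (hn : 1 ≤ n) :
    Filter.Tendsto (fun m => connector t m n) Filter.atTop (nhds 0) := by
  have h : Filter.Tendsto (fun m : ℕ => connector t m 1) Filter.atTop (nhds 0) := by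
    have h1 : ∀ m : ℕ, connector t m 1 = (1 - t) / ((m : ℝ) + (1 - t)) := by
      intro m
      have h3 := (shiftedFactorial_pos ht m).ne'
      have h1 : (m : ℝ) + 1 - t ≠ 0 := by
        have : (0 : ℝ) ≤ m := m.cast_nonneg
        linarith
      have h0 : shiftedFactorial t 1 = 1 - t := by simp [shiftedFactorial]
      rw [connector, shiftedFactorial_succ t m, h0, ← add_sub_assoc]
      field_simp
    simp only [h1]
    exact Filter.Tendsto.const_div_atTop
      (Filter.tendsto_atTop_add_const_right _ _ tendsto_natCast_atTop_atTop) _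
  refine squeeze_zero (fun m => (connector_pos ht m n).le) (fun m => ?_) h
  rw [connector_comm, connector_comm t m 1]
  exact connector_antitone_left ht m hn

/-- Transport relation for the connector. -/
theorem hasSum_connector (ht : t < 1) (m : ℕ) {n : ℕ} (hn : 1 ≤ n) :
    HasSum (fun d : ℕ => connector t (d + m + 1) n * (1 / (((d + m : ℕ) : ℝ) + 1 - t)))
      (1 / (n : ℝ) * connector t m n) := by
  have hn' : (0 : ℝ) < n := by exact_mod_cast hn
  have hterm : ∀ d : ℕ, connector t (d + m + 1) n * (1 / (((d + m : ℕ) : ℝ) + 1 - t)) =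
      1 / (n : ℝ) * (connector t (d + m) n - connector t (d + 1 + m) n) := by
    intro d
    rw [show d + 1 + m = d + m + 1 by ring, connector_sub_succ ht (d + m) n]
    field_simp
  have hpos : ∀ d : ℕ, 0 ≤ connector t (d + m + 1) n * (1 / (((d + m : ℕ) : ℝ) + 1 - t)) := by
    intro d
    have : (0 : ℝ) < ((d + m : ℕ) : ℝ) + 1 - t := by
      have : (0 : ℝ) ≤ ((d + m : ℕ) : ℝ) := Nat.cast_nonneg _
      linarith
    have := connector_pos ht (d + m + 1) n
    positivity
  rw [hasSum_iff_tendsto_nat_of_nonneg hpos]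
  simp only [hterm, ← mul_sum]
  refine Filter.Tendsto.const_mul _ ?_
  have h : ∀ k : ℕ, ∑ d ∈ range k, (connector t (d + m) n - connector t (d + 1 + m) n) =
      connector t m n - connector t (k + m) n := by
    intro k
    rw [sum_range_sub' (fun d => connector t (d + m) n), zero_add]
  simp only [h]
  simpa using ((tendsto_connector_left ht hn).comp (Filter.tendsto_add_atTop_nat m)).const_sub
    (connector t m n)

theorem chainSum_nonneg {w : ℕ → ℝ} (hw : ∀ i, 0 ≤ w i) (r n : ℕ) : 0 ≤ chainSum w r n := by
  induction r generalizing n with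
  | zero => simp [chainSum]
  | succ r ih => exact sum_nonneg fun j _ => mul_nonneg (hw j) (ih j)

theorem one_div_add_one_sub_nonneg (ht : t < 1) (i : ℕ) : 0 ≤ 1 / ((i : ℝ) + 1 - t) := by
  have : (0 : ℝ) ≤ i := i.cast_nonneg
  exact one_div_nonneg.2 (by linarith)

theorem hasSum_connector_chainSum (ht : t < 1) (r : ℕ) {a : ℕ} (ha : 1 ≤ a) :
    HasSum (fun i : ℕ => connector t (i + 1) a * (1 / ((i : ℝ) + 1 - t)) *
      chainSum (fun j : ℕ => 1 / ((j : ℝ) + 1 - t)) r i) ((1 / (a : ℝ)) ^ (r + 1)) := by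
  have hw := one_div_add_one_sub_nonneg ht
  induction r with
  | zero =>
    simpa [chainSum, connector_zero_left ht] using hasSum_connector ht 0 ha
  | succ r ih =>
    refine HasSum.mul_sum_range_of_nonneg
      (F := fun j => 1 / (a : ℝ) * connector t (j + 1) a)
      (fun i => mul_nonneg (connector_pos ht _ _).le (hw i))
      (fun i => mul_nonneg (hw i) (chainSum_nonneg hw r i))
      (fun j => hasSum_connector ht (j + 1) ha) ?_
    rw [pow_succ']
    refine HasSum.of_eq (ih.mul_left (1 / (a : ℝ))) fun j => ?_
    ring

/-- The generating function form of the sum formula. -/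
theorem hasSum_chainSum (ht : t < 1) (r : ℕ) {s : ℝ}
    (hs : HasSum (fun a : ℕ => (1 / ((a : ℝ) + 1)) ^ (r + 1) * (1 / ((a : ℝ) + 1 - t))) s) :
    HasSum (fun i : ℕ => 1 / ((i : ℝ) + 1) * (1 / ((i : ℝ) + 1 - t)) *
      chainSum (fun j : ℕ => 1 / ((j : ℝ) + 1 - t)) r i) s := by
  have hw := one_div_add_one_sub_nonneg ht
  refine HasSum.swap_of_nonneg (F := fun a i => connector t (i + 1) (a + 1) *
    (1 / ((i : ℝ) + 1 - t)) * chainSum (fun j : ℕ => 1 / ((j : ℝ) + 1 - t)) r i *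
      (1 / ((a : ℝ) + 1 - t))) ?_ ?_ ?_ hs
  · intro a i
    exact mul_nonneg (mul_nonneg (mul_nonneg (connector_pos ht _ _).le (hw i))
      (chainSum_nonneg hw r i)) (hw a)
  · intro a
    simpa using (hasSum_connector_chainSum ht r (Nat.le_add_left 1 a)).mul_right
      (1 / ((a : ℝ) + 1 - t))
  · intro i
    have h := hasSum_connector ht 0 (Nat.le_add_left 1 i)
    rw [connector_zero_left ht] at h
    have h2 := h.mul_right
      (1 / ((i : ℝ) + 1 - t) * chainSum (fun j : ℕ => 1 / ((j : ℝ) + 1 - t)) r i)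
    push_cast at h2
    simp only [add_zero, mul_one] at h2
    rw [mul_assoc]
    refine HasSum.of_eq (h2) fun a => ?_
    rw [connector_comm t (i + 1)]
    ring

end connector

section generating_functions

open PowerSeries

/-- The power series expansion of `1 / (a - x t)` in the variable `t`. -/
noncomputable def geomInv (x a : ℝ) : ℝ⟦X⟧ := PowerSeries.mk fun n => x ^ n / a ^ (n + 1)

theorem coeff_geomInv (x a : ℝ) (n : ℕ) : coeff n (geomInv x a) = x ^ n / a ^ (n + 1) :=
  coeff_mk _ _

theorem sub_mul_geomInv (x : ℝ) {a : ℝ} (ha : a ≠ 0) :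
    (C a - C x * X) * geomInv x a = 1 := by
  ext n
  rw [sub_mul, map_sub, mul_assoc, coeff_C_mul, coeff_C_mul, coeff_one, coeff_geomInv]
  cases n with
  | zero => simp [ha]
  | succ n =>
    rw [coeff_succ_X_mul, coeff_geomInv, if_neg n.succ_ne_zero]
    field_simp
    ring

/-- `p` has nonnegative coefficients and converges at `t` to `s`. -/
def EvaluatesTo (t : ℝ) (p : ℝ⟦X⟧) (s : ℝ) : Prop :=
  (∀ n, 0 ≤ coeff n p) ∧ HasSum (fun n => coeff n p * t ^ n) s

variable {t : ℝ}

theorem evaluatesTo_one (t : ℝ) : EvaluatesTo t 1 1 := by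
  refine ⟨fun n => ?_, ?_⟩
  · rw [coeff_one]; split_ifs <;> norm_num
  · convert! hasSum_single (f := fun n => coeff n (1 : ℝ⟦X⟧) * t ^ n) 0 ?_ using 1
    · simp
    · intro n hn
      simp [coeff_one, hn]

theorem EvaluatesTo.mul {p q : ℝ⟦X⟧} {r s : ℝ} (hp : EvaluatesTo t p r)
    (hq : EvaluatesTo t q s) : EvaluatesTo t (p * q) (r * s) := by
  refine ⟨fun n => ?_, ?_⟩
  · rw [coeff_mul]
    exact sum_nonneg fun x _ => mul_nonneg (hp.1 _) (hq.1 _)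
  · have hp' := hp.2.summable.norm
    have hq' := hq.2.summable.norm
    have h1 := tsum_mul_tsum_eq_tsum_sum_antidiagonal_of_summable_norm hp' hq'
    have h2 := (summable_norm_sum_mul_antidiagonal_of_summable_norm hp' hq').of_norm.hasSum
    rw [← h1, hp.2.tsum_eq, hq.2.tsum_eq] at h2
    refine h2.of_eq fun n => ?_
    rw [coeff_mul, sum_mul]
    refine sum_congr rfl fun x hx => ?_
    rw [← HasAntidiagonal.mem_antidiagonal.1 hx, pow_add]
    ring

theorem EvaluatesTo.sum {ι : Type*} {p : ι → ℝ⟦X⟧} {s : ι → ℝ} (I : Finset ι)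
    (hp : ∀ i ∈ I, EvaluatesTo t (p i) (s i)) :
    EvaluatesTo t (∑ i ∈ I, p i) (∑ i ∈ I, s i) := by
  refine ⟨fun n => ?_, ?_⟩
  · rw [map_sum]
    exact sum_nonneg fun i hi => (hp i hi).1 n
  · refine (hasSum_sum fun i hi => (hp i hi).2).of_eq fun n => ?_
    rw [map_sum, sum_mul]

theorem evaluatesTo_geomInv {x a : ℝ} (ha : 0 < a) (hx : 0 ≤ x) (ht : 0 ≤ t) (hxt : x * t < a) :
    EvaluatesTo t (geomInv x a) (1 / (a - x * t)) := by
  refine ⟨fun n => by rw [coeff_geomInv]; positivity, ?_⟩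
  have h := (hasSum_geometric_of_lt_one (div_nonneg (mul_nonneg hx ht) ha.le)
    ((div_lt_one ha).2 hxt)).mul_left (1 / a)
  have h1 : a - x * t ≠ 0 := (sub_pos.2 hxt).ne'
  rw [show 1 / a * (1 - x * t / a)⁻¹ = 1 / (a - x * t) by field_simp] at h
  refine h.of_eq fun n => ?_
  rw [coeff_geomInv, div_pow, mul_pow, pow_succ]
  field_simp

theorem EvaluatesTo.chainSum {p : ℕ → ℝ⟦X⟧} {s : ℕ → ℝ}
    (hp : ∀ i, EvaluatesTo t (p i) (s i)) (r n : ℕ) :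
    EvaluatesTo t (chainSum p r n) (_root_.chainSum s r n) := by
  induction r generalizing n with
  | zero => exact evaluatesTo_one t
  | succ r ih => exact EvaluatesTo.sum _ fun j _ => (hp j).mul (ih j)

theorem coeff_eq_zero_of_hasSum_zero {b : ℕ → ℝ}
    (hb : ∀ t : ℝ, 0 < t → t < 1 → HasSum (fun n => b n * t ^ n) 0) (n : ℕ) : b n = 0 := by
  induction n using Nat.strong_induction_on with
  | _ n ih =>
    have h0 : ∀ t : ℝ, 0 < t → t < 1 → HasSum (fun k => b (k + n) * t ^ k) 0 := by
      intro t h0 h1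
      have h := (hasSum_nat_add_iff' n).2 (hb t h0 h1)
      rw [sum_eq_zero fun i hi => by rw [ih i (mem_range.1 hi), zero_mul], sub_zero] at h
      have h2 := h.mul_right (1 / t ^ n)
      rw [zero_mul] at h2
      refine h2.of_eq fun k => ?_
      rw [pow_add]
      field_simp
    have hbound : Summable fun k => |b (k + n)| * (1 / 2 : ℝ) ^ k := by
      refine (h0 (1 / 2) (by norm_num) (by norm_num)).summable.abs.congr fun k => ?_
      rw [abs_mul, abs_of_nonneg (by positivity : (0 : ℝ) ≤ (1 / 2) ^ k)]
    have hev : ∀ᶠ t : ℝ in nhdsWithin 0 (Set.Ioi 0), t ∈ Set.Ioo (0 : ℝ) (1 / 2) :=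
      Ioo_mem_nhdsGT (by norm_num)
    have hlim : Filter.Tendsto (fun t : ℝ => ∑' k, b (k + n) * t ^ k)
        (nhdsWithin 0 (Set.Ioi 0)) (nhds (∑' k, b (k + n) * (0 : ℝ) ^ k)) := by
      refine tendsto_tsum_of_dominated_convergence hbound (fun k => ?_) ?_
      · have : Continuous fun t : ℝ => b (k + n) * t ^ k := by fun_prop
        exact (this.tendsto 0).mono_left nhdsWithin_le_nhds
      · filter_upwards [hev] with t ht k
        have := ht.1.le
        rw [Real.norm_eq_abs, abs_mul, abs_of_nonneg (by positivity : (0 : ℝ) ≤ t ^ k)]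
        gcongr
        exact ht.2.le
    have hzero : Filter.Tendsto (fun t : ℝ => ∑' k, b (k + n) * t ^ k)
        (nhdsWithin 0 (Set.Ioi 0)) (nhds 0) := by
      refine tendsto_const_nhds.congr' ?_
      filter_upwards [hev] with t ht
      exact (h0 t ht.1 (by linarith [ht.2])).tsum_eq.symm
    have h := tendsto_nhds_unique hlim hzero
    rw [tsum_eq_single 0 fun k hk => by rw [zero_pow hk, mul_zero]] at h
    simpa using h

theorem hasSum_rz {l : ℕ} (hl : 2 ≤ l) :
    HasSum (fun a : ℕ => 1 / ((a : ℝ) + 1) ^ l) (rz l) := by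
  have h1 : Summable fun m : ℕ => if 0 < m then 1 / (m : ℝ) ^ l else 0 := by
    refine (Real.summable_one_div_nat_pow.2 hl).congr fun m => ?_
    rcases Nat.eq_zero_or_pos m with rfl | hm
    · simp; omega
    · rw [if_pos hm]
  have h2 := (hasSum_nat_add_iff' 1).2 h1.hasSum
  simp only [range_one, sum_singleton, lt_irrefl, if_false, sub_zero] at h2
  refine h2.of_eq fun a => ?_
  rw [if_pos a.succ_pos]
  push_cast
  rfl

/-- The generating series of the truncated depth `r + 1` zeta values ending at `i + 1`. -/
noncomputable def chainTerm (r i : ℕ) : ℝ⟦X⟧ :=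
  geomInv 0 (i + 1) * geomInv 1 (i + 1) * chainSum (fun j : ℕ => geomInv 1 (j + 1)) r i

theorem evaluatesTo_chainTerm (h0 : 0 ≤ t) (h1 : t < 1) (r i : ℕ) :
    EvaluatesTo t (chainTerm r i) (1 / ((i : ℝ) + 1) * (1 / ((i : ℝ) + 1 - t)) *
      chainSum (fun j : ℕ => 1 / ((j : ℝ) + 1 - t)) r i) := by
  have hpos : ∀ j : ℕ, (0 : ℝ) < j + 1 := fun j => by positivity
  have hu : ∀ j : ℕ, EvaluatesTo t (geomInv 1 (j + 1)) (1 / ((j : ℝ) + 1 - t)) := by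
    intro j
    have h : (1 : ℝ) * t < j + 1 := by have : (0 : ℝ) ≤ j := j.cast_nonneg; linarith
    simpa using evaluatesTo_geomInv (hpos j) zero_le_one h0 h
  refine (EvaluatesTo.mul ?_ (hu i)).mul (EvaluatesTo.chainSum hu r i)
  simpa using evaluatesTo_geomInv (hpos i) le_rfl h0 (by simpa using hpos i)

/-- The sum formula for multiple zeta values of depth `r + 1`. -/
theorem hasSum_coeff_chainTerm {r : ℕ} (hr : 1 ≤ r) (n : ℕ) :
    HasSum (fun i => coeff n (chainTerm r i)) (rz (n + r + 2)) := by
  have hS : ∀ t : ℝ, 0 < t → t < 1 → ∃ s : ℝ,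
      HasSum (fun a : ℕ => (1 / ((a : ℝ) + 1)) ^ (r + 1) * (1 / ((a : ℝ) + 1 - t))) s := by
    intro t h0 h1
    refine Summable.of_nonneg_of_le (fun a => mul_nonneg (by positivity)
      (one_div_add_one_sub_nonneg h1 a)) (fun a => ?_)
      ((hasSum_rz (l := r + 1) (by omega)).summable.mul_right (1 / (1 - t)))
    rw [one_div_pow]
    have : (0 : ℝ) ≤ a := a.cast_nonneg
    gcongr
    linarith
  have hsum : ∀ n, Summable fun i => coeff n (chainTerm r i) := by
    intro n
    obtain ⟨s, hs⟩ := hS (1 / 2) (by norm_num) (by norm_num)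
    have hev := fun i => evaluatesTo_chainTerm (t := 1 / 2) (by norm_num) (by norm_num) r i
    refine Summable.of_nonneg_of_le (fun i => (hev i).1 n) (fun i => ?_)
      ((hasSum_chainSum (by norm_num) r hs).summable.mul_right (2 ^ n))
    have h := le_hasSum (hev i).2 n fun m _ => mul_nonneg ((hev i).1 m) (by positivity)
    calc coeff n (chainTerm r i) = coeff n (chainTerm r i) * (1 / 2) ^ n * 2 ^ n := by
          rw [mul_assoc, ← mul_pow]; norm_num
      _ ≤ _ := by gcongr
  have hdiff := coeff_eq_zero_of_hasSum_zero
    (b := fun n => ∑' i, coeff n (chainTerm r i) - rz (n + r + 2)) ?_ n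
  · rw [← sub_eq_zero.1 hdiff]
    exact (hsum n).hasSum
  intro t h0 h1
  obtain ⟨s, hs⟩ := hS t h0 h1
  have hev := evaluatesTo_chainTerm h0.le h1 r
  have hleft : HasSum (fun n => (∑' i, coeff n (chainTerm r i)) * t ^ n) s :=
    HasSum.swap_of_nonneg (F := fun i n => coeff n (chainTerm r i) * t ^ n)
      (fun i n => mul_nonneg ((hev i).1 n) (by positivity)) (fun i => (hev i).2)
      (fun n => (hsum n).hasSum.mul_right _) (hasSum_chainSum h1 r hs)
  have hright : HasSum (fun n => rz (n + r + 2) * t ^ n) s := by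
    refine HasSum.swap_of_nonneg
      (F := fun a n => 1 / ((a : ℝ) + 1) ^ (n + r + 2) * t ^ n)
      (fun a n => by positivity) (fun a => ?_)
      (fun n => (hasSum_rz (by omega)).mul_right _) hs
    have ha : (1 : ℝ) * t < a + 1 := by have : (0 : ℝ) ≤ a := a.cast_nonneg; linarith
    have h := (evaluatesTo_geomInv (by positivity) zero_le_one h0.le ha).2.mul_left
      ((1 / ((a : ℝ) + 1)) ^ (r + 1))
    rw [one_mul] at h
    refine h.of_eq fun n => ?_
    rw [coeff_geomInv, one_pow, one_div_pow]
    field_simp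
    ring
  have h := hleft.sub hright
  rw [sub_self] at h
  exact h.of_eq fun n => sub_mul _ _ _

end generating_functions

section summability

/-- Harmonic numbers as real numbers. -/
noncomputable def harmonicSum (n : ℕ) : ℝ := ∑ j ∈ range n, 1 / ((j : ℝ) + 1)

theorem harmonicSum_nonneg (n : ℕ) : 0 ≤ harmonicSum n := sum_nonneg fun j _ => by positivity

theorem harmonicSum_mono : Monotone harmonicSum := fun _ _ h =>
  sum_le_sum_of_subset_of_nonneg (range_mono h) fun j _ _ => by positivity

theorem harmonicSum_le_rpow {n : ℕ} (hn : 1 ≤ n) : harmonicSum n ≤ 5 * (n : ℝ) ^ (1 / 4 : ℝ) := by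
  have hn' : (1 : ℝ) ≤ n := by exact_mod_cast hn
  have h1 := harmonic_le_one_add_log n
  have h2 := Real.log_le_rpow_div (x := (n : ℝ)) (ε := 1 / 4) (by linarith) (by norm_num)
  have h3 := Real.one_le_rpow hn' (z := 1 / 4) (by norm_num)
  have h4 : ((harmonic n : ℚ) : ℝ) = harmonicSum n := by
    simp [harmonic, harmonicSum]
  rw [h4] at h1
  linarith

theorem summable_harmonicSum_sq_div_sq :
    Summable fun p : ℕ => 1 / ((p : ℝ) + 1) ^ 2 * harmonicSum (p + 1) * harmonicSum (p + 1) := by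
  have h := (summable_nat_add_iff 1).2
    ((Real.summable_one_div_nat_rpow (p := 3 / 2)).2 (by norm_num)) |>.mul_left 25
  refine Summable.of_nonneg_of_le (fun p => ?_) (fun p => ?_) h
  · have := harmonicSum_nonneg (p + 1)
    positivity
  · have h0 := harmonicSum_nonneg (p + 1)
    have h1 := harmonicSum_le_rpow (Nat.le_add_left 1 p)
    have hp : (0 : ℝ) < ((p + 1 : ℕ) : ℝ) := by positivity
    have h2 : 1 / ((p : ℝ) + 1) ^ 2 = 1 / (((p + 1 : ℕ) : ℝ) ^ (2 : ℝ)) := by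
      rw [Real.rpow_two]; push_cast; rfl
    calc 1 / ((p : ℝ) + 1) ^ 2 * harmonicSum (p + 1) * harmonicSum (p + 1)
        ≤ 1 / ((p : ℝ) + 1) ^ 2 * (5 * ((p + 1 : ℕ) : ℝ) ^ (1 / 4 : ℝ)) *
          (5 * ((p + 1 : ℕ) : ℝ) ^ (1 / 4 : ℝ)) := by gcongr
      _ = 25 * (((p + 1 : ℕ) : ℝ) ^ (1 / 4 : ℝ) * ((p + 1 : ℕ) : ℝ) ^ (1 / 4 : ℝ) /
          ((p + 1 : ℕ) : ℝ) ^ (2 : ℝ)) := by rw [h2]; ring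
      _ = 25 * (1 / ((p + 1 : ℕ) : ℝ) ^ (3 / 2 : ℝ)) := by
        rw [← Real.rpow_add hp, ← Real.rpow_sub hp, one_div (_ ^ _), ← Real.rpow_neg hp.le]
        norm_num
      _ ≤ _ := le_rfl

/-- The part of the series `tz a b c` with largest summation index `i + 1`. -/
noncomputable def tzTerm (a b c i : ℕ) : ℝ :=
  1 / ((i : ℝ) + 1) ^ a *
    ∑ j ∈ range i, 1 / ((j : ℝ) + 1) ^ b * ∑ k ∈ range j, 1 / ((k : ℝ) + 1) ^ c

theorem one_div_add_one_pow_le {a b : ℕ} (h : b ≤ a) (i : ℕ) :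
    1 / ((i : ℝ) + 1) ^ a ≤ 1 / ((i : ℝ) + 1) ^ b := by
  have : (0 : ℝ) ≤ i := i.cast_nonneg
  gcongr
  linarith

theorem tzTerm_nonneg (a b c i : ℕ) : 0 ≤ tzTerm a b c i :=
  mul_nonneg (by positivity) (sum_nonneg fun j _ => mul_nonneg (by positivity)
    (sum_nonneg fun k _ => by positivity))

theorem summable_tzTerm {a b c : ℕ} (ha : 2 ≤ a) (hb : 1 ≤ b) (hc : 1 ≤ c) :
    Summable (tzTerm a b c) := by
  refine Summable.of_nonneg_of_le (tzTerm_nonneg a b c) (fun i => ?_)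
    summable_harmonicSum_sq_div_sq
  rw [mul_assoc]
  refine mul_le_mul (one_div_add_one_pow_le ha i) ?_ (sum_nonneg fun j _ =>
    mul_nonneg (by positivity) (sum_nonneg fun k _ => by positivity)) (by positivity)
  have hk : ∀ j ∈ range i, ∑ k ∈ range j, 1 / ((k : ℝ) + 1) ^ c ≤ harmonicSum (i + 1) := by
    intro j hj
    refine (sum_le_sum fun k _ => (one_div_add_one_pow_le hc k).trans_eq (by rw [pow_one])).trans
      (harmonicSum_mono ?_)
    have := mem_range.1 hj
    omega
  calc ∑ j ∈ range i, 1 / ((j : ℝ) + 1) ^ b * ∑ k ∈ range j, 1 / ((k : ℝ) + 1) ^ c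
      ≤ ∑ j ∈ range i, 1 / ((j : ℝ) + 1) * harmonicSum (i + 1) := by
        refine sum_le_sum fun j hj => mul_le_mul
          ((one_div_add_one_pow_le hb j).trans_eq (by rw [pow_one])) (hk j hj)
          (sum_nonneg fun k _ => by positivity) (by positivity)
    _ = harmonicSum i * harmonicSum (i + 1) := by rw [← sum_mul]; rfl
    _ ≤ _ := mul_le_mul_of_nonneg_right (harmonicSum_mono i.le_succ) (harmonicSum_nonneg _)

theorem hasSum_tzTerm {a b c : ℕ} (ha : 2 ≤ a) (hb : 1 ≤ b) (hc : 1 ≤ c) :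
    HasSum (tzTerm a b c) (tz a b c) := by
  set F : ℕ × ℕ × ℕ → ℝ := fun t => if t.2.1 < t.1 ∧ t.2.2 < t.2.1 ∧ 0 < t.2.2 then
    1 / ((t.1 : ℝ) ^ a * (t.2.1 : ℝ) ^ b * (t.2.2 : ℝ) ^ c) else 0 with hF
  have hF0 : 0 ≤ F := by
    intro t
    simp only [hF, Pi.zero_apply]
    split_ifs
    · positivity
    · exact le_rfl
  have hrow : ∀ m, HasSum (fun y => F (m, y)) (∑ y ∈ range m ×ˢ range m, F (m, y)) := by
    intro m
    refine hasSum_sum_of_ne_finset_zero fun y hy => ?_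
    rw [mem_product, mem_range, mem_range] at hy
    simp only [hF]
    rw [if_neg (by omega)]
  have hterm : ∀ i, ∑ y ∈ range (i + 1) ×ˢ range (i + 1), F (i + 1, y) = tzTerm a b c i := by
    intro i
    rw [sum_product, sum_range_succ', sum_eq_zero (s := range (i + 1))
      (f := fun y => F (i + 1, 0, y)) (fun y _ => if_neg (by dsimp only; omega)), add_zero, tzTerm, mul_sum]
    refine sum_congr rfl fun j hj => ?_
    rw [mem_range] at hj
    rw [sum_range_succ', show F (i + 1, j + 1, 0) = 0 from if_neg (by simp), add_zero, mul_sum,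
      mul_sum]
    symm
    refine sum_subset_zero_on_sdiff (range_mono hj.le) (fun k hk => ?_) (fun k hk => ?_)
    · rw [mem_sdiff, mem_range, mem_range] at hk
      exact if_neg (by dsimp only; omega)
    · rw [mem_range] at hk
      simp only [hF]
      rw [if_pos (by omega)]
      push_cast
      field_simp
  have hshift : HasSum (fun m => ∑ y ∈ range m ×ˢ range m, F (m, y)) (∑' i, tzTerm a b c i) := by
    refine (hasSum_nat_add_iff' 1).1 ?_
    simp only [hterm, range_one, sum_singleton, range_zero, product_empty, sum_empty, sub_zero]
    exact (summable_tzTerm ha hb hc).hasSum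
  have hsum : Summable F := by
    refine (summable_prod_of_nonneg hF0).2 ⟨fun m => (hrow m).summable, ?_⟩
    simpa only [(hrow _).tsum_eq] using hshift.summable
  have htz : tz a b c = ∑' i, tzTerm a b c i :=
    (hsum.hasSum.prod_fiberwise hrow).unique hshift
  rw [htz]
  exact (summable_tzTerm ha hb hc).hasSum

end summability

section limits

open PowerSeries

theorem geomInv_mul_geomInv (i j : ℕ) :
    geomInv 1 ((i : ℝ) + 1) * geomInv 1 ((j : ℝ) + 1) =
      geomInv 2 (((i + j + 1 : ℕ) : ℝ) + 1) *
        (geomInv 1 ((i : ℝ) + 1) + geomInv 1 ((j : ℝ) + 1)) := by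
  have hi := sub_mul_geomInv 1 (a := (i : ℝ) + 1) (by positivity)
  have hj := sub_mul_geomInv 1 (a := (j : ℝ) + 1) (by positivity)
  have hij := sub_mul_geomInv 2 (a := ((i + j + 1 : ℕ) : ℝ) + 1) (by positivity)
  push_cast [map_add, map_one] at hi hj hij ⊢
  rw [show (C (2 : ℝ) : ℝ⟦X⟧) = C 1 + C 1 by rw [← map_add]; norm_num, map_one] at hij
  set u := geomInv 1 ((i : ℝ) + 1)
  set u' := geomInv 1 ((j : ℝ) + 1)
  set v := geomInv 2 ((i : ℝ) + j + 1 + 1)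
  linear_combination v * u' * hi + v * u * hj - u * u' * hij

theorem geomInv_zero_mul_sub (p q : ℕ) :
    geomInv 0 ((p : ℝ) + 1) *
        (geomInv 1 ((q : ℝ) + 1) - geomInv 1 (((p + q + 1 : ℕ) : ℝ) + 1)) =
      geomInv 1 ((q : ℝ) + 1) * geomInv 1 (((p + q + 1 : ℕ) : ℝ) + 1) := by
  have hp := sub_mul_geomInv 0 (a := (p : ℝ) + 1) (by positivity)
  have hq := sub_mul_geomInv 1 (a := (q : ℝ) + 1) (by positivity)
  have hpq := sub_mul_geomInv 1 (a := ((p + q + 1 : ℕ) : ℝ) + 1) (by positivity)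
  push_cast [map_add, map_one, map_zero] at hp hq hpq ⊢
  set c := geomInv 0 ((p : ℝ) + 1)
  set u := geomInv 1 ((q : ℝ) + 1)
  set u' := geomInv 1 ((p : ℝ) + q + 1 + 1)
  linear_combination c * u' * hq - c * u * hpq + u * u' * hp

theorem geomInv_one_sub_geomInv_zero (p : ℕ) :
    geomInv 1 ((p : ℝ) + 1) - geomInv 0 ((p : ℝ) + 1) =
      X * (geomInv 0 ((p : ℝ) + 1) * geomInv 1 ((p : ℝ) + 1)) := by
  have h0 := sub_mul_geomInv 0 (a := (p : ℝ) + 1) (by positivity)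
  have h1 := sub_mul_geomInv 1 (a := (p : ℝ) + 1) (by positivity)
  simp only [map_one, map_zero] at h0 h1
  linear_combination geomInv 0 ((p : ℝ) + 1) * h1 - geomInv 1 ((p : ℝ) + 1) * h0

theorem derivative_geomInv (x : ℝ) {a : ℝ} (ha : a ≠ 0) :
    derivative ℝ (geomInv x a) = C x * geomInv x a ^ 2 := by
  have h := sub_mul_geomInv x ha
  have h1 := congrArg (derivative ℝ) h
  rw [Derivation.leibniz, map_sub, Derivation.leibniz, derivative_C, derivative_C, derivative_X,
    Derivation.map_one_eq_zero] at h1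
  simp only [smul_eq_mul] at h1
  linear_combination geomInv x a * h1 - derivative ℝ (geomInv x a) * h

theorem sub_mul_eq_chainTerm (p : ℕ) :
    (geomInv 1 ((p : ℝ) + 1) - geomInv 0 ((p : ℝ) + 1)) *
      (3 * chainSum (fun j : ℕ => geomInv 1 ((j : ℝ) + 1)) 2 p +
        ∑ j ∈ range p, geomInv 1 ((j : ℝ) + 1) ^ 2 +
        geomInv 1 ((p : ℝ) + 1) * chainSum (fun j : ℕ => geomInv 1 ((j : ℝ) + 1)) 1 p) =
      X * (3 * chainTerm 2 p + derivative ℝ (chainTerm 1 p)) := by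
  have hne : ∀ j : ℕ, (j : ℝ) + 1 ≠ 0 := fun j => by positivity
  have h : derivative ℝ (chainSum (fun j : ℕ => geomInv 1 ((j : ℝ) + 1)) 1 p) =
      ∑ j ∈ range p, geomInv 1 ((j : ℝ) + 1) ^ 2 := by
    simp only [chainSum, mul_one, map_sum]
    refine sum_congr rfl fun j _ => ?_
    rw [derivative_geomInv 1 (hne j), map_one, one_mul]
  rw [geomInv_one_sub_geomInv_zero, chainTerm, chainTerm, Derivation.leibniz, Derivation.leibniz,
    h, derivative_geomInv _ (hne p), derivative_geomInv _ (hne p), map_one, map_zero]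
  simp only [smul_eq_mul]
  ring

theorem hasSum_coeff_main_term (n : ℕ) :
    HasSum (fun p : ℕ => coeff (n + 1)
      ((geomInv 1 ((p : ℝ) + 1) - geomInv 0 ((p : ℝ) + 1)) *
      (3 * chainSum (fun j : ℕ => geomInv 1 ((j : ℝ) + 1)) 2 p +
        ∑ j ∈ range p, geomInv 1 ((j : ℝ) + 1) ^ 2 +
        geomInv 1 ((p : ℝ) + 1) * chainSum (fun j : ℕ => geomInv 1 ((j : ℝ) + 1)) 1 p)))
      (((n + 4 : ℕ) : ℝ) * rz (n + 4)) := by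
  have h1 := (hasSum_coeff_chainTerm (r := 2) (by norm_num) n).mul_left 3
  have h2 := (hasSum_coeff_chainTerm (r := 1) le_rfl (n + 1)).mul_right ((n : ℝ) + 1)
  have h := h1.add h2
  rw [show n + 2 + 2 = n + 4 by ring, show n + 1 + 1 + 2 = n + 4 by ring,
    show 3 * rz (n + 4) + rz (n + 4) * ((n : ℝ) + 1) = ((n + 4 : ℕ) : ℝ) * rz (n + 4) by
      push_cast; ring] at h
  refine h.of_eq fun p => ?_
  rw [sub_mul_eq_chainTerm, coeff_succ_X_mul, map_add, coeff_derivative,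
    show (3 : ℝ⟦X⟧) = C 3 from (map_ofNat C 3).symm, coeff_C_mul]

theorem abs_coeff_mul_le {p q : ℝ⟦X⟧} {B D : ℝ} {k : ℕ} (hD : 0 ≤ D)
    (hp : ∀ i ≤ k, |coeff i p| ≤ B) (hq : ∀ i ≤ k, |coeff i q| ≤ D) :
    ∀ i ≤ k, |coeff i (p * q)| ≤ ((k : ℝ) + 1) * (B * D) := by
  intro i hi
  have hB : 0 ≤ B := (abs_nonneg _).trans (hp i hi)
  rw [coeff_mul]
  refine (abs_sum_le_sum_abs _ _).trans ?_
  calc ∑ x ∈ antidiagonal i, |coeff x.1 p * coeff x.2 q| ≤ ∑ x ∈ antidiagonal i, B * D := by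
        refine sum_le_sum fun x hx => ?_
        have := HasAntidiagonal.mem_antidiagonal.1 hx
        rw [abs_mul]
        exact mul_le_mul (hp _ (by omega)) (hq _ (by omega)) (abs_nonneg _) hB
    _ = ((i : ℝ) + 1) * (B * D) := by
        rw [sum_const, Nat.card_antidiagonal, nsmul_eq_mul]; push_cast; rfl
    _ ≤ _ := by gcongr

theorem abs_coeff_geomInv_one_le (m i : ℕ) :
    |coeff i (geomInv 1 ((m : ℝ) + 1))| ≤ 1 / ((m : ℝ) + 1) := by
  rw [coeff_geomInv, one_pow, abs_of_nonneg (by positivity)]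
  exact (one_div_add_one_pow_le (Nat.le_add_left 1 i) m).trans_eq (by rw [pow_one])

theorem abs_coeff_sum_geomInv_one_le (s n i : ℕ) :
    |coeff i (∑ j ∈ range n, geomInv 1 (((s + j : ℕ) : ℝ) + 1))| ≤
      ∑ j ∈ range n, 1 / (((s + j : ℕ) : ℝ) + 1) := by
  rw [map_sum]
  exact (abs_sum_le_sum_abs _ _).trans (sum_le_sum fun j _ => abs_coeff_geomInv_one_le _ i)

theorem abs_coeff_geomInv_sub_le (p i : ℕ) :
    |coeff i (geomInv 1 ((p : ℝ) + 1) - geomInv 0 ((p : ℝ) + 1))| ≤ 1 / ((p : ℝ) + 1) ^ 2 := by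
  rw [map_sub, coeff_geomInv, coeff_geomInv]
  cases i with
  | zero => simp; positivity
  | succ i =>
    rw [one_pow, zero_pow i.succ_ne_zero, zero_div, sub_zero, abs_of_nonneg (by positivity)]
    exact one_div_add_one_pow_le (by omega) p

theorem abs_coeff_error_le (k : ℕ) {N p : ℕ} (hp : p < N) :
    |coeff k ((geomInv 1 ((p : ℝ) + 1) - geomInv 0 ((p : ℝ) + 1)) *
        chainSum (fun j : ℕ => geomInv 1 ((j : ℝ) + 1)) 1 p *
      (chainSum (fun j : ℕ => geomInv 1 ((j : ℝ) + 1)) 1 N -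
        chainSum (fun j : ℕ => geomInv 1 ((j : ℝ) + 1)) 1 (N - 1 - p)))| ≤
    ((k : ℝ) + 1) * (((k : ℝ) + 1) * (1 / ((p : ℝ) + 1) ^ 2 * harmonicSum (p + 1)) *
      ∑ j ∈ range (p + 1), 1 / (((N - 1 - p + j : ℕ) : ℝ) + 1)) := by
  have h1 : chainSum (fun j : ℕ => geomInv 1 ((j : ℝ) + 1)) 1 N -
      chainSum (fun j : ℕ => geomInv 1 ((j : ℝ) + 1)) 1 (N - 1 - p) =
      ∑ j ∈ range (p + 1), geomInv 1 (((N - 1 - p + j : ℕ) : ℝ) + 1) := by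
    obtain ⟨s, rfl⟩ : ∃ s, N = s + (p + 1) := ⟨N - (p + 1), by omega⟩
    rw [show s + (p + 1) - 1 - p = s by omega]
    simp only [chainSum, mul_one]
    rw [sum_range_add, add_sub_cancel_left]
  have h2 : ∀ i ≤ k, |coeff i (chainSum (fun j : ℕ => geomInv 1 ((j : ℝ) + 1)) 1 p)| ≤
      harmonicSum (p + 1) := by
    intro i _
    have h := abs_coeff_sum_geomInv_one_le 0 p i
    simp only [zero_add] at h
    simp only [chainSum, mul_one]
    exact h.trans (harmonicSum_mono p.le_succ)
  rw [h1]
  exact abs_coeff_mul_le (sum_nonneg fun j _ => by positivity)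
    (abs_coeff_mul_le (harmonicSum_nonneg _) (fun i _ => abs_coeff_geomInv_sub_le p i) h2)
    (fun i _ => abs_coeff_sum_geomInv_one_le _ _ i) k le_rfl

theorem tendsto_coeff_error (k : ℕ) :
    Filter.Tendsto (fun N : ℕ => coeff k (∑ p ∈ range N,
      (geomInv 1 ((p : ℝ) + 1) - geomInv 0 ((p : ℝ) + 1)) *
        chainSum (fun j : ℕ => geomInv 1 ((j : ℝ) + 1)) 1 p *
      (chainSum (fun j : ℕ => geomInv 1 ((j : ℝ) + 1)) 1 N -
        chainSum (fun j : ℕ => geomInv 1 ((j : ℝ) + 1)) 1 (N - 1 - p))))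
      Filter.atTop (nhds 0) := by
  set E : ℕ → ℕ → ℝ⟦X⟧ := fun N p => (geomInv 1 ((p : ℝ) + 1) - geomInv 0 ((p : ℝ) + 1)) *
        chainSum (fun j : ℕ => geomInv 1 ((j : ℝ) + 1)) 1 p *
      (chainSum (fun j : ℕ => geomInv 1 ((j : ℝ) + 1)) 1 N -
        chainSum (fun j : ℕ => geomInv 1 ((j : ℝ) + 1)) 1 (N - 1 - p))
  have htsum : ∀ N, coeff k (∑ p ∈ range N, E N p) =
      ∑' p, if p < N then coeff k (E N p) else 0 := by
    intro N
    rw [map_sum, tsum_eq_sum (s := range N) fun p hp => if_neg fun h => hp (mem_range.2 h)]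
    exact sum_congr rfl fun p hp => (if_pos (mem_range.1 hp)).symm
  have hbound := summable_harmonicSum_sq_div_sq.mul_left (((k : ℝ) + 1) * ((k : ℝ) + 1))
  have h := tendsto_tsum_of_dominated_convergence (𝓕 := Filter.atTop)
    (f := fun N p => if p < N then coeff k (E N p) else 0) (g := fun _ => 0) hbound ?_ ?_
  · simp only [← htsum, tsum_zero] at h
    exact h
  · intro p
    have hj : ∀ j : ℕ, Filter.Tendsto (fun N : ℕ => 1 / (((N - 1 - p + j : ℕ) : ℝ) + 1))
        Filter.atTop (nhds 0) := fun j =>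
      tendsto_one_div_add_atTop_nhds_zero_nat.comp ((Filter.tendsto_add_atTop_nat j).comp
        ((Filter.tendsto_sub_atTop_nat p).comp (Filter.tendsto_sub_atTop_nat 1)))
    have hs := (tendsto_finsetSum (range (p + 1)) fun j _ => hj j).const_mul
      (((k : ℝ) + 1) * (1 / ((p : ℝ) + 1) ^ 2 * harmonicSum (p + 1))) |>.const_mul ((k : ℝ) + 1)
    simp only [sum_const_zero, mul_zero] at hs
    refine squeeze_zero_norm' ?_ hs
    filter_upwards [Filter.eventually_gt_atTop p] with N hN
    rw [if_pos hN]
    exact abs_coeff_error_le k hN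
  · refine Filter.Eventually.of_forall fun N p => ?_
    have h0 := harmonicSum_nonneg (p + 1)
    split_ifs with hp
    · refine (abs_coeff_error_le k hp).trans ?_
      have : ∑ j ∈ range (p + 1), 1 / (((N - 1 - p + j : ℕ) : ℝ) + 1) ≤ harmonicSum (p + 1) := by
        refine sum_le_sum fun j _ => ?_
        push_cast
        gcongr
        exact le_add_of_nonneg_left (Nat.cast_nonneg _)
      calc ((k : ℝ) + 1) * (((k : ℝ) + 1) * (1 / ((p : ℝ) + 1) ^ 2 * harmonicSum (p + 1)) *
            ∑ j ∈ range (p + 1), 1 / (((N - 1 - p + j : ℕ) : ℝ) + 1))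
          ≤ ((k : ℝ) + 1) * (((k : ℝ) + 1) * (1 / ((p : ℝ) + 1) ^ 2 * harmonicSum (p + 1)) *
            harmonicSum (p + 1)) := by gcongr
        _ = _ := by ring
    · rw [norm_zero]
      positivity

theorem coeff_triple_sum (x y : ℝ) (k N : ℕ) :
    coeff k (∑ m ∈ range N, geomInv x ((m : ℝ) + 1) * ∑ p ∈ range m, geomInv y ((p : ℝ) + 1) *
      chainSum (fun j : ℕ => geomInv 1 ((j : ℝ) + 1)) 1 p) =
    ∑ a ∈ antidiagonal k, ∑ b ∈ antidiagonal a.2,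
      x ^ a.1 * y ^ b.1 * ∑ i ∈ range N, tzTerm (a.1 + 1) (b.1 + 1) (b.2 + 1) i := by
  simp only [map_sum, coeff_mul, chainSum, mul_one, coeff_geomInv, one_pow]
  rw [sum_comm]
  refine sum_congr rfl fun a _ => ?_
  simp only [mul_sum (s := range N)]
  rw [sum_comm (s := antidiagonal a.2)]
  refine sum_congr rfl fun m _ => ?_
  rw [sum_comm (s := range m), mul_sum]
  refine sum_congr rfl fun b _ => ?_
  simp only [tzTerm, mul_sum]
  exact sum_congr rfl fun p _ => sum_congr rfl fun q _ => by ring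

end limits

theorem sum_TIdx_eq (k : ℕ) (f : ℕ → ℕ → ℕ → ℝ) :
    ∑ t ∈ TIdx (k + 3),
      ((2 : ℝ) ^ (t.1 + t.2.1 - 1) + 2 ^ (t.1 - 1) - 2 ^ t.2.1) * f t.1 t.2.1 t.2.2 =
    ∑ a ∈ antidiagonal k, ∑ b ∈ antidiagonal a.2,
      (2 * (2 ^ a.1 * 2 ^ b.1) + 2 ^ a.1 - 2 * 2 ^ b.1 - 0 ^ a.1) *
        f (a.1 + 1) (b.1 + 1) (b.2 + 1) := by
  rw [sum_sigma']
  refine sum_of_injOn (fun t => ⟨(t.1 - 1, k + 1 - t.1), (t.2.1 - 1, t.2.2 - 1)⟩) ?_ ?_ ?_ ?_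
  · rintro ⟨a, b, c⟩ h ⟨a', b', c'⟩ h' heq
    simp only [TIdx, coe_filter, mem_product, mem_range, Set.mem_ofPred_eq] at h h'
    simp only [Sigma.mk.injEq, Prod.mk.injEq, heq_eq_eq] at heq
    simp only [Prod.mk.injEq]
    omega
  · rintro ⟨a, b, c⟩ h
    simp only [TIdx, coe_filter, mem_product, mem_range, Set.mem_ofPred_eq] at h
    simp only [coe_sigma, Set.mem_sigma_iff, mem_coe, HasAntidiagonal.mem_antidiagonal]
    omega
  · rintro ⟨⟨a, s⟩, ⟨b, c⟩⟩ h hne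
    simp only [mem_sigma, HasAntidiagonal.mem_antidiagonal] at h
    rcases Nat.eq_zero_or_pos a with rfl | ha
    · simp
    · refine absurd ⟨(a + 1, b + 1, c + 1), ?_, ?_⟩ hne
      · simp only [TIdx, coe_filter, mem_product, mem_range, Set.mem_ofPred_eq]
        omega
      · simp only [Sigma.mk.injEq, Prod.mk.injEq, heq_eq_eq]
        omega
  · rintro ⟨a, b, c⟩ h
    simp only [TIdx, mem_filter, mem_product, mem_range] at h
    obtain ⟨a, rfl⟩ : ∃ a', a = a' + 2 := ⟨a - 2, by omega⟩
    obtain ⟨b, rfl⟩ : ∃ b', b = b' + 1 := ⟨b - 1, by omega⟩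
    obtain ⟨c, rfl⟩ : ∃ c', c = c' + 1 := ⟨c - 1, by omega⟩
    rw [show a + 2 - 1 = a + 1 by omega]
    simp only [Nat.add_sub_cancel]
    rw [show a + 2 + (b + 1) - 1 = (a + 1) + b + 1 by omega, zero_pow a.succ_ne_zero]
    ring

theorem weighted_sum_guo_xie (l : ℕ) (hl : 4 ≤ l) :
    (∑ t ∈ TIdx l,
      ((2 : ℝ) ^ (t.1 + t.2.1 - 1) + 2 ^ (t.1 - 1) - 2 ^ t.2.1) * tz t.1 t.2.1 t.2.2) =
      (l : ℝ) * rz l := by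
  obtain ⟨n, rfl⟩ : ∃ n, l = n + 4 := ⟨l - 4, by omega⟩
  have htrunc : ∀ N : ℕ, ∑ t ∈ TIdx (n + 4),
      ((2 : ℝ) ^ (t.1 + t.2.1 - 1) + 2 ^ (t.1 - 1) - 2 ^ t.2.1) *
        ∑ i ∈ range N, tzTerm t.1 t.2.1 t.2.2 i = _ := fun N => by
    have h := congrArg (PowerSeries.coeff (n + 1))
      (truncated_weighted_sum (u := fun p : ℕ => geomInv 1 ((p : ℝ) + 1))
        (v := fun p : ℕ => geomInv 2 ((p : ℝ) + 1)) (c := fun p : ℕ => geomInv 0 ((p : ℝ) + 1))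
        geomInv_mul_geomInv geomInv_zero_mul_sub N)
    refine Eq.trans ?_ h
    have h2 : ∀ m, chainSum (fun p : ℕ => geomInv 1 ((p : ℝ) + 1)) 2 m = ∑ p ∈ range m,
      geomInv 1 ((p : ℝ) + 1) * chainSum (fun p : ℕ => geomInv 1 ((p : ℝ) + 1)) 1 p :=
        fun m => rfl
    rw [sum_TIdx_eq (n + 1) fun a b c => ∑ i ∈ range N, tzTerm a b c i,
      show (2 : PowerSeries ℝ) = PowerSeries.C 2 from (map_ofNat PowerSeries.C 2).symm]
    simp only [h2, map_add, map_sub, PowerSeries.coeff_C_mul, coeff_triple_sum, one_pow, one_mul,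
      mul_one, mul_sum (s := antidiagonal _), ← sum_add_distrib, ← sum_sub_distrib]
    exact sum_congr rfl fun a _ => sum_congr rfl fun b _ => by ring
  have hleft : Filter.Tendsto (fun N : ℕ => ∑ t ∈ TIdx (n + 4),
      ((2 : ℝ) ^ (t.1 + t.2.1 - 1) + 2 ^ (t.1 - 1) - 2 ^ t.2.1) *
        ∑ i ∈ range N, tzTerm t.1 t.2.1 t.2.2 i) Filter.atTop
      (nhds (∑ t ∈ TIdx (n + 4),
        ((2 : ℝ) ^ (t.1 + t.2.1 - 1) + 2 ^ (t.1 - 1) - 2 ^ t.2.1) * tz t.1 t.2.1 t.2.2)) := by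
    refine tendsto_finsetSum _ fun t ht => Filter.Tendsto.const_mul _ ?_
    obtain ⟨-, h1, h2, h3, -⟩ := mem_filter.1 ht
    exact (hasSum_tzTerm h1 h2 h3).tendsto_sum_nat
  refine tendsto_nhds_unique hleft ?_
  simp only [htrunc, map_sub]
  simpa only [map_sum, sub_zero] using
    (hasSum_coeff_main_term n).tendsto_sum_nat.sub (tendsto_coeff_error (n + 1))
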